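/- arXiv:2108.07306 — 7 statements merged into one kernel-verified Lean document; each statement's English description precedes it below -/
import Mathlib

section
/- Let G be a group, U a finite-dimensional complex vector space carrying a linear representation ρ of G, and ω a nondegenerate alternating bilinear form on U that is invariant under ρ (ω(ρ(g)u, ρ(g)u') = ω(u,u') for all g, u, u'). Suppose V ⊆ U is a ρ-invariant Lagrangian subspace (ω vanishes identically on V × V and dim V = (1/2) dim U) that admits a ρ-invariant linear complement in U. Then there exists a G-equivariant linear isomorphism f : U → V ⊕ V* (where G acts on V ⊕ V* by g·(v,φ) = (ρ(g)v, φ ∘ ρ(g)⁻¹)) such that ω(u, u') = ω₀(f(u), f(u')) for all u, u' ∈ U, where ω₀ is the standard symplectic form ω₀((v,φ),(w,ψ)) = ψ(v) − φ(w) on V ⊕ V*. -/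
/-- If a symplectic `G`-module `U` admits an invariant Lagrangian subspace `V` with an
invariant complement, then `U` is equivariantly symplectically isomorphic to `V ⊕ V*`
with the standard symplectic form. -/
theorem stmt_0 {G U : Type*} [Group G] [AddCommGroup U] [Module ℂ U]
    [FiniteDimensional ℂ U]
    (ρ : Representation ℂ G U)
    (ω : U →ₗ[ℂ] U →ₗ[ℂ] ℂ)
    (halt : ∀ u, ω u u = 0)
    (hnd : ∀ u, (∀ u', ω u u' = 0) → u = 0)
    (hinv : ∀ g u u', ω (ρ g u) (ρ g u') = ω u u')
    (V : Submodule ℂ U)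
    (hVinv : ∀ g, ∀ u ∈ V, ρ g u ∈ V)
    (hlag : ∀ u ∈ V, ∀ u' ∈ V, ω u u' = 0)
    (hdim : 2 * Module.finrank ℂ V = Module.finrank ℂ U)
    (hcompl : ∃ W : Submodule ℂ U, IsCompl V W ∧ ∀ g, ∀ u ∈ W, ρ g u ∈ W) :
    ∃ f : U ≃ₗ[ℂ] V × Module.Dual ℂ V,
      (∀ g u, ((f (ρ g u)).1 : U) = ρ g ((f u).1 : U)) ∧
      (∀ g u, ∀ (v : U) (hv : v ∈ V),
        (f (ρ g u)).2 ⟨v, hv⟩ = (f u).2 ⟨ρ g⁻¹ v, hVinv g⁻¹ v hv⟩) ∧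
      (∀ u u', ω u u' = (f u').2 (f u).1 - (f u).2 (f u').1) := by
  obtain ⟨W, hVW, hWinv⟩ := hcompl
  have hskew : ∀ u u', ω u u' = - ω u' u := by
    intro u u'
    have h := halt (u + u')
    simp only [map_add, LinearMap.add_apply, halt] at h
    linear_combination h
  obtain ⟨p, r, hpr⟩ : ∃ (p : U →ₗ[ℂ] V) (r : U →ₗ[ℂ] W), ∀ u, (p u : U) + (r u : U) = u := by
    let E := Submodule.prodEquivOfIsCompl V W hVW
    refine ⟨LinearMap.fst ℂ V W ∘ₗ E.symm.toLinearMap, LinearMap.snd ℂ V W ∘ₗ E.symm.toLinearMap,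
      fun u => ?_⟩
    have h := E.apply_symm_apply u
    rw [Submodule.coe_prodEquivOfIsCompl' V W hVW] at h
    exact h
  have huniq : ∀ a ∈ V, ∀ b ∈ W, ∀ a' ∈ V, ∀ b' ∈ W, a + b = a' + b' → a = a' ∧ b = b' := by
    intro a ha b hb a' ha' b' hb' h
    have h1 : a - a' = b' - b := by
      rw [sub_eq_sub_iff_add_eq_add, h, add_comm]
    have h2 : a - a' = 0 := by
      refine (Submodule.disjoint_def.1 hVW.disjoint) _ (V.sub_mem ha ha') ?_
      rw [h1]; exact W.sub_mem hb' hb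
    have h3 : a = a' := sub_eq_zero.1 h2
    exact ⟨h3, by rw [h3] at h; exact add_left_cancel h⟩
  have hpg : ∀ g u, (p (ρ g u) : U) = ρ g (p u) ∧ (r (ρ g u) : U) = ρ g (r u) := by
    intro g u
    refine huniq _ (p _).2 _ (r _).2 _ (hVinv g _ (p u).2) _ (hWinv g _ (r u).2) ?_
    rw [hpr, ← map_add, hpr]
  have hinj0 : ∀ v ∈ V, (∀ w ∈ W, ω v w = 0) → v = 0 := by
    intro v hv h
    refine hnd v fun u => ?_
    rw [← hpr u, map_add, hlag v hv _ (p u).2, h _ (r u).2, add_zero]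
  let e0 : V →ₗ[ℂ] Module.Dual ℂ W := (ω.domRestrict₁₂ V W)
  have he0 : ∀ v w, e0 v w = ω v w := fun v w => rfl
  have he0inj : Function.Injective e0 := by
    rw [← LinearMap.ker_eq_bot, LinearMap.ker_eq_bot']
    intro v hv
    refine Subtype.ext (hinj0 v v.2 fun w hw => ?_)
    rw [← he0 v ⟨w, hw⟩, hv]; rfl
  have hfr : Module.finrank ℂ V = Module.finrank ℂ (Module.Dual ℂ W) := by
    have := Submodule.finrank_add_eq_of_isCompl hVW
    rw [Subspace.dual_finrank_eq]; omega
  let e : V ≃ₗ[ℂ] Module.Dual ℂ W := LinearEquiv.ofInjectiveOfFinrankEq e0 he0inj hfr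
  have he : ∀ v w, e v w = ω v w := fun v w => rfl
  let s : U →ₗ[ℂ] V := e.symm.toLinearMap ∘ₗ (((1/2 : ℂ) • ω.domRestrict₁₂ W W) ∘ₗ r)
  have hs : ∀ u, ∀ w ∈ W, ω (s u) w = (1/2 : ℂ) * ω (r u) w := by
    intro u w hw
    rw [← he (s u) ⟨w, hw⟩]
    have : e (s u) = (((1/2 : ℂ) • ω.domRestrict₁₂ W W) ∘ₗ r) u := e.apply_symm_apply _
    rw [this]; rfl
  have hinv' : ∀ g u u', ω (ρ g u) u' = ω u (ρ g⁻¹ u') := by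
    intro g u u'
    rw [← hinv g u (ρ g⁻¹ u')]
    simp
  have hsg : ∀ g u, (s (ρ g u) : U) = ρ g (s u) := by
    intro g u
    refine sub_eq_zero.1 (hinj0 _ (V.sub_mem (s _).2 (hVinv g _ (s u).2)) fun w hw => ?_)
    rw [map_sub, LinearMap.sub_apply, hs _ w hw, hinv', hs _ _ (hWinv _ _ hw), (hpg g u).2, hinv',
      sub_self]
  let f0 : U →ₗ[ℂ] V × Module.Dual ℂ V := (p + s).prod ((ω.domRestrict V).flip)
  have hf1 : ∀ u, ((f0 u).1 : U) = p u + s u := fun u => rfl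
  have hf2 : ∀ u v, (f0 u).2 v = ω v u := fun u v => rfl
  have hω : ∀ u u', ω u u' = (f0 u').2 (f0 u).1 - (f0 u).2 (f0 u').1 := by
    intro u u'
    rw [hf2, hf2, hf1, hf1]
    have h1 : ∀ (v : V) x, ω v x = ω v (r x) := by
      intro v x
      conv_lhs => rw [← hpr x, map_add, hlag v v.2 _ (p x).2, zero_add]
    have h2 : ω u u' = ω (p u) (r u') + ω (r u) (p u') + ω (r u) (r u') := by
      conv_lhs => rw [← hpr u, ← hpr u']
      simp only [map_add, LinearMap.add_apply, hlag _ (p u).2 _ (p u').2]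
      ring
    rw [h2]
    simp only [map_add, LinearMap.add_apply]
    rw [h1 (p u) u', h1 (s u) u', h1 (p u') u, h1 (s u') u, hs _ _ (r _).2, hs _ _ (r _).2,
      hskew (r u) (p u'), hskew (r u') (r u)]
    ring
  have hf0inj : Function.Injective f0 := by
    rw [← LinearMap.ker_eq_bot, LinearMap.ker_eq_bot']
    intro u hu
    refine hnd u fun u' => ?_
    rw [hω, hu]; simp
  have hfr2 : Module.finrank ℂ U = Module.finrank ℂ (V × Module.Dual ℂ V) := by
    rw [Module.finrank_prod, Subspace.dual_finrank_eq]; omega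
  refine ⟨LinearEquiv.ofInjectiveOfFinrankEq f0 hf0inj hfr2, ?_, ?_, hω⟩
  · intro g u
    change ((f0 (ρ g u)).1 : U) = ρ g ((f0 u).1 : U)
    rw [hf1, hf1, (hpg g u).1, hsg, map_add]
  · intro g u v hv
    change ω v (ρ g u) = ω (ρ g⁻¹ v) u
    rw [hinv', inv_inv]
end

section
/- Let V be a finite-dimensional complex vector space, 𝔤 a finite-dimensional complex vector space, and φ : 𝔤 → End(V) a linear map. For m ≥ 0, let N_m ⊆ V^{m+1} × (V*)^{m+1} denote the set of ((x_0,…,x_m),(ξ_0,…,ξ_m)) such that Σ_{i+j=k} ξ_i(φ(A)(x_j)) = 0 for every A ∈ 𝔤 and every 0 ≤ k ≤ m. Then: (1) for m = 1, the set of elements of N_1 with x_0 = 0 and ξ_0 = 0 is all of {0} × V × {0} × V*, i.e. x_1 and ξ_1 are arbitrary; (2) for m ≥ 2, the map ((0,x_1,…,x_m),(0,ξ_1,…,ξ_m)) ↦ (((x_1,…,x_{m−1}),(ξ_1,…,ξ_{m−1})), x_m, ξ_m) is a bijection from { ((x⃗),(ξ⃗)) ∈ N_m : x_0 = 0, ξ_0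 = 0 } onto N_{m−2} × V × V*. -/
theorem aux_sum (n k : ℕ) (hk : k ≤ n + 2) (f : Fin (n + 3) → Fin (n + 3) → ℂ)
    (h0 : ∀ j, f 0 j = 0) (h1 : ∀ i, f i 0 = 0) :
    (∑ i : Fin (n + 3), ∑ j : Fin (n + 3), if (i : ℕ) + (j : ℕ) = k then f i j else 0) =
    ∑ i : Fin (n + 1), ∑ j : Fin (n + 1), if (i : ℕ) + (j : ℕ) + 2 = k then
      f ⟨(i : ℕ) + 1, by omega⟩ ⟨(j : ℕ) + 1, by omega⟩ else 0 := by
  have e1 : (∑ j : Fin (n + 3), if ((0 : Fin (n + 3)) : ℕ) + (j : ℕ) = k then f 0 j else 0) = 0 :=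
    Finset.sum_eq_zero (fun j _ => by simp [h0])
  have e2 : (∑ j : Fin (n + 3), if ((Fin.last (n + 1)).succ : ℕ) + (j : ℕ) = k then
      f (Fin.last (n + 1)).succ j else 0) = 0 := by
    refine Finset.sum_eq_zero (fun j _ => ?_)
    split_ifs with h
    · have : j = 0 := by
        refine Fin.ext ?_
        simp only [Fin.val_succ, Fin.val_last, Fin.val_zero] at h ⊢
        omega
      rw [this, h1]
    · rfl
  rw [Fin.sum_univ_succ, e1, Fin.sum_univ_castSucc, e2, zero_add, add_zero]
  refine Finset.sum_congr rfl (fun i _ => ?_)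
  rw [Fin.sum_univ_succ, Fin.sum_univ_castSucc, h1, ite_self, zero_add, if_neg, add_zero]
  · refine Finset.sum_congr rfl (fun j _ => ?_)
    refine if_congr ?_ rfl rfl
    simp
    omega
  · simp
    omega

/-- The fiber of `ρ_m : N_m → N` over the origin: for `m = 1` it is all of `V × V*`
(in the `(x₁, ξ₁)` coordinates), and for `m ≥ 2` it is in bijection with
`N_{m-2} × V × V*`. -/
theorem stmt_4 {V 𝔤 : Type*} [AddCommGroup V] [Module ℂ V] [FiniteDimensional ℂ V]
    [AddCommGroup 𝔤] [Module ℂ 𝔤] [FiniteDimensional ℂ 𝔤]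
    (φ : 𝔤 →ₗ[ℂ] V →ₗ[ℂ] V)
    (Nset : ∀ ℓ : ℕ, Set ((Fin (ℓ + 1) → V) × (Fin (ℓ + 1) → Module.Dual ℂ V)))
    (hN : ∀ ℓ p, p ∈ Nset ℓ ↔ ∀ A : 𝔤, ∀ k : ℕ, k ≤ ℓ →
      (∑ i : Fin (ℓ + 1), ∑ j : Fin (ℓ + 1),
        if (i : ℕ) + (j : ℕ) = k then p.2 i (φ A (p.1 j)) else 0) = 0) :
    ({p ∈ Nset 1 | p.1 0 = 0 ∧ p.2 0 = 0} =
      {p : (Fin 2 → V) × (Fin 2 → Module.Dual ℂ V) | p.1 0 = 0 ∧ p.2 0 = 0}) ∧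
    (∀ m : ℕ, (hm : 2 ≤ m) →
      Set.BijOn
        (fun p : (Fin (m + 1) → V) × (Fin (m + 1) → Module.Dual ℂ V) =>
          (((fun i : Fin (m - 2 + 1) => p.1 ⟨(i : ℕ) + 1, by have := i.isLt; omega⟩),
            (fun i : Fin (m - 2 + 1) => p.2 ⟨(i : ℕ) + 1, by have := i.isLt; omega⟩)),
           (p.1 ⟨m, by omega⟩, p.2 ⟨m, by omega⟩)))
        {p ∈ Nset m | p.1 0 = 0 ∧ p.2 0 = 0}
        (Nset (m - 2) ×ˢ (Set.univ : Set (V × Module.Dual ℂ V)))) := by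
  constructor
  · ext p
    simp only [Set.mem_ofPred_eq, and_iff_right_iff_imp]
    rintro ⟨h0, h1⟩
    rw [hN]
    intro A k hk
    change (∑ i : Fin 2, ∑ j : Fin 2,
        if (i : ℕ) + (j : ℕ) = k then p.2 i (φ A (p.1 j)) else 0) = 0
    have h2 : ¬ (1 + 1 = k) := by omega
    simp [Fin.sum_univ_two, h0, h1]
    omega
  · intro m hm
    obtain ⟨n, rfl⟩ : ∃ n, m = n + 2 := ⟨m - 2, by omega⟩
    have key : ∀ p : (Fin (n + 2 + 1) → V) × (Fin (n + 2 + 1) → Module.Dual ℂ V),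
        p.1 0 = 0 → p.2 0 = 0 → (p ∈ Nset (n + 2) ↔
          ((fun i : Fin (n + 1) => p.1 ⟨(i : ℕ) + 1, by omega⟩),
            (fun i : Fin (n + 1) => p.2 ⟨(i : ℕ) + 1, by omega⟩)) ∈ Nset n) := by
      intro p h0 h1
      rw [hN, hN]
      refine forall_congr' fun A => ?_
      have e := fun k hk => aux_sum n k hk (fun i j => p.2 i (φ A (p.1 j)))
        (by simp [h1]) (by simp [h0])
      constructor
      · intro h k hk
        have := h (k + 2) (by omega)
        rw [e (k + 2) (by omega)] at this
        simpa using this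
      · intro h k hk
        rw [e k hk]
        rcases Nat.lt_or_ge k 2 with h2 | h2
        · refine Finset.sum_eq_zero fun i _ => Finset.sum_eq_zero fun j _ => if_neg (by omega)
        · obtain ⟨l, rfl⟩ : ∃ l, k = l + 2 := ⟨k - 2, by omega⟩
          simpa using h l (by omega)
    refine ⟨?_, ?_, ?_⟩
    · rintro p ⟨hp, h0, h1⟩
      exact ⟨(key p h0 h1).1 hp, Set.mem_univ _⟩
    · rintro p ⟨hp, h0, h1⟩ q ⟨hq, h0', h1'⟩ h
      simp only [Prod.mk.injEq] at h
      obtain ⟨⟨ha, hb⟩, hc, hd⟩ := h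
      have cases : ∀ i : Fin (n + 2 + 1), i = 0 ∨ i = ⟨n + 2, by omega⟩ ∨
          ∃ j : Fin (n + 1), i = ⟨(j : ℕ) + 1, by omega⟩ := by
        intro i
        by_cases hi : (i : ℕ) = 0
        · left
          ext
          simpa using hi
        · by_cases hi' : (i : ℕ) = n + 2
          · right; left
            ext
            simpa using hi'
          · right; right
            refine ⟨⟨(i : ℕ) - 1, by omega⟩, ?_⟩
            ext
            simp
            omega
      refine Prod.ext (funext fun i => ?_) (funext fun i => ?_)
      · rcases cases i with rfl | rfl | ⟨j, rfl⟩
        · rw [h0, h0']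
        · exact hc
        · exact congrFun ha j
      · rcases cases i with rfl | rfl | ⟨j, rfl⟩
        · rw [h1, h1']
        · exact hd
        · exact congrFun hb j
    · rintro ⟨⟨x, ξ⟩, y, η⟩ ⟨hx, -⟩
      let p : (Fin (n + 2 + 1) → V) × (Fin (n + 2 + 1) → Module.Dual ℂ V) :=
        (Fin.cons 0 (Fin.snoc (α := fun _ => V) x y),
          Fin.cons 0 (Fin.snoc (α := fun _ => Module.Dual ℂ V) ξ η))
      have a1 : (fun i : Fin (n + 1) => p.1 ⟨(i : ℕ) + 1, by omega⟩) = x := by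
        funext i
        exact Fin.snoc_castSucc (α := fun _ => V) y x i
      have a2 : (fun i : Fin (n + 1) => p.2 ⟨(i : ℕ) + 1, by omega⟩) = ξ := by
        funext i
        exact Fin.snoc_castSucc (α := fun _ => Module.Dual ℂ V) η ξ i
      have a3 : p.1 ⟨n + 2, by omega⟩ = y := Fin.snoc_last (α := fun _ => V) y x
      have a4 : p.2 ⟨n + 2, by omega⟩ = η := Fin.snoc_last (α := fun _ => Module.Dual ℂ V) η ξ
      refine ⟨p, ⟨(key p rfl rfl).2 ?_, rfl, rfl⟩, ?_⟩
      · rw [a1, a2]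
        exact hx
      · exact Prod.ext (Prod.ext a1 a2) (Prod.ext a3 a4)
end

section
/- Let W be a 2n-dimensional complex vector space (n ≥ 1) equipped with a nondegenerate alternating bilinear form ω, and let k ≥ 2. Suppose L is a linear subspace of W^k such that for every (w_1,…,w_k) ∈ L and all 1 ≤ i, j ≤ k one has ω(w_i, w_j) = 0. Then dim L ≤ k·n. -/
lemma aux_sub {V : Type*} [AddCommGroup V] [Module ℂ V] [FiniteDimensional ℂ V]
    (A B C : Submodule ℂ V) (hA : A ≤ C) (hB : B ≤ C) :
    Module.finrank ℂ A + Module.finrank ℂ B ≤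
      Module.finrank ℂ (A ⊓ B : Submodule ℂ V) + Module.finrank ℂ C := by
  have h := Submodule.finrank_sup_add_finrank_inf_eq A B
  have h2 := Submodule.finrank_mono (sup_le hA hB)
  omega

lemma aux_ind {V : Type*} [AddCommGroup V] [Module ℂ V] [FiniteDimensional ℂ V]
    {ι : Type*} [DecidableEq ι] (n : ℕ) (U : ι → Submodule ℂ V)
    (hU : ∀ i j, i ≠ j → Module.finrank ℂ V ≤ Module.finrank ℂ (U i ⊓ U j : Submodule ℂ V) + 2 * n) :
    ∀ (k : ℕ) (S : Finset ι), S.card = k → 2 ≤ k →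
      Module.finrank ℂ V ≤ Module.finrank ℂ (S.inf U : Submodule ℂ V) + k * n := by
  have htop : Module.finrank ℂ (⊤ : Submodule ℂ V) = Module.finrank ℂ V := finrank_top ℂ V
  intro k
  induction k using Nat.strong_induction_on with
  | _ k ih =>
  intro S hS hk
  by_cases h2 : k = 2
  · subst h2
    obtain ⟨x, y, hxy, rfl⟩ := Finset.card_eq_two.1 hS
    rw [Finset.inf_insert, Finset.inf_singleton]
    exact hU x y hxy
  by_cases h3 : k = 3
  · subst h3
    obtain ⟨x, y, z, hxy, hxz, hyz, rfl⟩ := Finset.card_eq_three.1 hS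
    have a := hU x y hxy
    have b := hU y z hyz
    have c := hU x z hxz
    have e := aux_sub (U x ⊓ U y) (U y ⊓ U z) (U y) inf_le_right inf_le_left
    have f := aux_sub (U y) (U x ⊓ U z) ⊤ le_top le_top
    have e1 : (U x ⊓ U y) ⊓ (U y ⊓ U z) = ({x, y, z} : Finset ι).inf U := by
      ext v; simp; tauto
    have f1 : U y ⊓ (U x ⊓ U z) = ({x, y, z} : Finset ι).inf U := by
      ext v; simp; tauto
    rw [e1] at e
    rw [f1] at f
    omega
  obtain ⟨T, hTS, hT⟩ := Finset.exists_subset_card_eq (s := S) (n := 2) (by omega)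
  have hc : (S \ T).card = k - 2 := by rw [Finset.card_sdiff_of_subset hTS]; omega
  have a := ih 2 (by omega) T hT le_rfl
  have b := ih (k - 2) (by omega) (S \ T) hc (by omega)
  have e := aux_sub (T.inf U) ((S \ T).inf U) ⊤ le_top le_top
  rw [← Finset.inf_union, Finset.union_sdiff_of_subset hTS] at e
  obtain ⟨m, rfl⟩ : ∃ m, k = m + 2 := ⟨k - 2, by omega⟩
  simp only [Nat.add_sub_cancel] at b
  have : (m + 2) * n = m * n + 2 * n := by ring
  omega

lemma aux_pair {V W : Type*} [AddCommGroup V] [Module ℂ V] [FiniteDimensional ℂ V]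
    [AddCommGroup W] [Module ℂ W] [FiniteDimensional ℂ W]
    (n : ℕ) (hdim : Module.finrank ℂ W = 2 * n)
    (ω : W →ₗ[ℂ] W →ₗ[ℂ] ℂ)
    (halt : ∀ w, ω w w = 0)
    (hnd : ∀ w, (∀ w', ω w w' = 0) → w = 0)
    (f g : V →ₗ[ℂ] W) (h : ∀ v, ω (f v) (g v) = 0) :
    Module.finrank ℂ V ≤
      Module.finrank ℂ (LinearMap.ker f ⊓ LinearMap.ker g : Submodule ℂ V) + 2 * n := by
  have hanti : ∀ a b, ω a b = - ω b a := by
    intro a b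
    have := halt (a + b)
    simp only [map_add, LinearMap.add_apply, halt] at this
    linear_combination this
  let B : W × W →ₗ[ℂ] Module.Dual ℂ (W × W) :=
    LinearMap.coprod ((LinearMap.lcomp ℂ ℂ (LinearMap.snd ℂ W W)).comp ω)
      (-((LinearMap.lcomp ℂ ℂ (LinearMap.fst ℂ W W)).comp ω))
  have hB : ∀ p q : W × W, B p q = ω p.1 q.2 - ω p.2 q.1 := by
    intro p q; simp [B, sub_eq_add_neg]
  have hinj : Function.Injective B := by
    rw [injective_iff_map_eq_zero]
    intro p hp
    have hp' : ∀ q, B p q = 0 := by intro q; rw [hp]; rfl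
    ext
    · exact hnd _ fun w => by have := hp' (0, w); rw [hB] at this; simpa using this
    · exact hnd _ fun w => by have := hp' (w, 0); rw [hB] at this; simpa using this
  let R := LinearMap.range (f.prod g)
  have hle : R.map B ≤ R.dualAnnihilator := by
    rintro _ ⟨_, ⟨v, rfl⟩, rfl⟩
    rw [Submodule.mem_dualAnnihilator]
    rintro _ ⟨u, rfl⟩
    rw [hB]
    have h1 := h (v + u)
    simp only [map_add, LinearMap.add_apply, h] at h1
    have h2 := hanti (f u) (g v)
    change ω (f v) (g u) - ω (g v) (f u) = 0
    linear_combination h1 - h2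
  have h1 := Submodule.finrank_mono hle
  rw [(Submodule.equivMapOfInjective B hinj R).finrank_eq.symm] at h1
  have h2 := Subspace.finrank_add_finrank_dualAnnihilator_eq R
  rw [Module.finrank_prod, hdim] at h2
  have h3 := LinearMap.finrank_range_add_finrank_ker (f.prod g)
  rw [LinearMap.ker_prod] at h3
  change Module.finrank ℂ R + _ = _ at h3
  omega

/-- A linear subspace of the null cone of `k` copies of the defining representation of
`Sp_{2n}(ℂ)` has dimension at most `k·n`: if every pair of components of every point of
`L` is `ω`-orthogonal, then `dim L ≤ k·n`. -/
theorem stmt_6 {W : Type*} [AddCommGroup W] [Module ℂ W] [FiniteDimensional ℂ W]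
    (n k : ℕ) (hn : 1 ≤ n) (hk : 2 ≤ k)
    (hdim : Module.finrank ℂ W = 2 * n)
    (ω : W →ₗ[ℂ] W →ₗ[ℂ] ℂ)
    (halt : ∀ w, ω w w = 0)
    (hnd : ∀ w, (∀ w', ω w w' = 0) → w = 0)
    (L : Submodule ℂ (Fin k → W))
    (hL : ∀ w ∈ L, ∀ i j, ω (w i) (w j) = 0) :
    Module.finrank ℂ L ≤ k * n := by
  let U : Fin k → Submodule ℂ L := fun i => LinearMap.ker ((LinearMap.proj i).comp L.subtype)
  have h := aux_ind n U (fun i j _ => aux_pair n hdim ω halt hnd _ _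
    (fun v => hL v.1 v.2 i j)) k Finset.univ (by simp) hk
  have h0 : Finset.univ.inf U = ⊥ := by
    rw [eq_bot_iff]
    intro v hv
    rw [Submodule.mem_bot]
    ext i
    have : v ∈ U i := (Finset.inf_le (f := U) (Finset.mem_univ i)) hv
    simpa [U] using this
  rw [h0, finrank_bot] at h
  omega
end

section
/- Let V be an n-dimensional complex vector space and let p ≥ q ≥ n ≥ 1. Suppose L is a linear subspace of V^p × (V*)^q such that for every point (v_1,…,v_p, ξ_1,…,ξ_q) ∈ L one has ξ_j(v_i) = 0 for all 1 ≤ i ≤ p and 1 ≤ j ≤ q. Then dim L ≤ n·p. Moreover, if p > q and dim L = n·p, then L = V^p × {0}. -/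
/-- The functional `v ↦ ∑ j, ξ j (v (f j))`, linear in `ξ`. -/
noncomputable def phiAux {V : Type*} [AddCommGroup V] [Module ℂ V] {p q : ℕ} (f : Fin q → Fin p) :
    (Fin q → Module.Dual ℂ V) →ₗ[ℂ] Module.Dual ℂ (Fin p → V) where
  toFun ξ := ∑ j, (ξ j).comp (LinearMap.proj (f j))
  map_add' a b := by
    ext; simp [Finset.sum_add_distrib]
  map_smul' c a := by
    ext; simp [Finset.mul_sum]

theorem phiAux_apply {V : Type*} [AddCommGroup V] [Module ℂ V] {p q : ℕ} (f : Fin q → Fin p)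
    (ξ : Fin q → Module.Dual ℂ V) (v : Fin p → V) : phiAux f ξ v = ∑ j, ξ j (v (f j)) := by
  simp [phiAux]

theorem phiAux_inj {V : Type*} [AddCommGroup V] [Module ℂ V] {p q : ℕ} (f : Fin q → Fin p)
    (hf : Function.Injective f) : Function.Injective (phiAux (V := V) f) := by
  rw [injective_iff_map_eq_zero]
  intro ξ h
  funext j
  ext v
  have := congrArg (fun g => g (Pi.single (f j) v)) h
  simp only [phiAux_apply] at this
  rw [Finset.sum_eq_single j] at this
  · simpa using this
  · intro b _ hb
    rw [Pi.single_eq_of_ne (fun h => hb (hf h)), map_zero]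
  · simp

theorem keyAux {V : Type*} [AddCommGroup V] [Module ℂ V] [FiniteDimensional ℂ V]
    (p q : ℕ) (L : Submodule ℂ ((Fin p → V) × (Fin q → Module.Dual ℂ V)))
    (hL : ∀ z ∈ L, ∀ (i : Fin p) (j : Fin q), z.2 j (z.1 i) = 0)
    (f : Fin q → Fin p) (hf : Function.Injective f) :
    Module.finrank ℂ L ≤ Module.finrank ℂ V * p ∧
      (Module.finrank ℂ L = Module.finrank ℂ V * p →
        ∀ i, (∀ j, f j ≠ i) → ∀ v : V, (Pi.single i v, 0) ∈ L) := by
  set s : L →ₗ[ℂ] (Fin q → Module.Dual ℂ V) := (LinearMap.snd ℂ _ _).comp L.subtype with hs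
  set g : LinearMap.ker s →ₗ[ℂ] (Fin p → V) :=
    ((LinearMap.fst ℂ _ _).comp L.subtype).comp (LinearMap.ker s).subtype with hg
  have hginj : Function.Injective g := by
    rw [injective_iff_map_eq_zero]
    rintro ⟨⟨⟨a, b⟩, hz⟩, hk⟩ h
    have h1 : a = 0 := h
    have h2 : b = 0 := hk
    subst h1 h2
    rfl
  set W := (LinearMap.range s).map (phiAux (V := V) f) with hW
  have hWd : Module.finrank ℂ W = Module.finrank ℂ (LinearMap.range s) :=
    (Submodule.equivMapOfInjective _ (phiAux_inj f hf) _).finrank_eq.symm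
  set N := W.dualCoannihilator with hN
  have hNd : Module.finrank ℂ W + Module.finrank ℂ N = Module.finrank ℂ V * p := by
    have := Subspace.finrank_add_finrank_dualCoannihilator_eq W
    rw [this]
    simp [Module.finrank_pi_fintype, mul_comm]
  have hrk := LinearMap.finrank_range_add_finrank_ker s
  have hgd := LinearMap.finrank_range_of_inj hginj
  have hle : LinearMap.range g ≤ N := by
    rintro _ ⟨⟨⟨⟨a, b⟩, hz⟩, hk⟩, rfl⟩
    have h2 : b = 0 := hk
    subst h2
    rw [hN, Submodule.mem_dualCoannihilator]
    rintro _ ⟨_, ⟨⟨⟨a', b'⟩, hz'⟩, rfl⟩, rfl⟩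
    change phiAux f b' a = 0
    rw [phiAux_apply]
    apply Finset.sum_eq_zero
    intro j _
    have e1 := hL _ (L.add_mem hz hz') (f j) j
    have e2 := hL _ hz' (f j) j
    simp at e1 e2
    simpa [e2] using e1
  have hle' := Submodule.finrank_mono hle
  refine ⟨by omega, fun hd i hi v => ?_⟩
  have heq : LinearMap.range g = N := Submodule.eq_of_le_of_finrank_eq hle (by omega)
  have hm : Pi.single i v ∈ N := by
    rw [hN, Submodule.mem_dualCoannihilator]
    rintro _ ⟨ξ, -, rfl⟩
    rw [phiAux_apply]
    apply Finset.sum_eq_zero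
    intro j _
    rw [Pi.single_eq_of_ne (hi j), map_zero]
  rw [← heq] at hm
  obtain ⟨⟨⟨⟨a, b⟩, hz⟩, hk⟩, h⟩ := hm
  have h1 : a = Pi.single i v := h
  have h2 : b = 0 := hk
  subst h1 h2
  exact hz

/-- A linear subspace of the null cone of the `GL_n(ℂ)`-module `p ℂⁿ ⊕ q (ℂⁿ)*`
(with `p ≥ q ≥ n`) has dimension at most `n·p`; if `p > q` and the dimension is exactly
`n·p`, the subspace is `V^p × {0}`. -/
theorem stmt_7 {V : Type*} [AddCommGroup V] [Module ℂ V] [FiniteDimensional ℂ V]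
    (n p q : ℕ) (hn : Module.finrank ℂ V = n) (h1 : 1 ≤ n) (hq : n ≤ q) (hp : q ≤ p)
    (L : Submodule ℂ ((Fin p → V) × (Fin q → Module.Dual ℂ V)))
    (hL : ∀ z ∈ L, ∀ (i : Fin p) (j : Fin q), z.2 j (z.1 i) = 0) :
    Module.finrank ℂ L ≤ n * p ∧
      (q < p → Module.finrank ℂ L = n * p →
        L = (⊤ : Submodule ℂ (Fin p → V)).prod
              (⊥ : Submodule ℂ (Fin q → Module.Dual ℂ V))) := by
  subst hn
  refine ⟨(keyAux p q L hL (Fin.castLE hp) (Fin.castLE_injective hp)).1, fun hlt hd => ?_⟩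
  symm
  have hs : ∀ (i : Fin p) (v : V), (Pi.single i v, 0) ∈ L := by
    intro i v
    obtain ⟨r, rfl⟩ : ∃ r, p = r + 1 := ⟨p - 1, by omega⟩
    have hqr : q ≤ r := by omega
    exact (keyAux _ q L hL (fun j => i.succAbove (Fin.castLE hqr j))
      (Fin.succAbove_right_injective.comp (Fin.castLE_injective hqr))).2 hd i
      (fun j => Fin.succAbove_ne _ _) v
  have hr : (⊤ : Submodule ℂ (Fin p → V)).prod (⊥ : Submodule ℂ (Fin q → Module.Dual ℂ V))
      = LinearMap.range (LinearMap.inl ℂ (Fin p → V) (Fin q → Module.Dual ℂ V)) := by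
    ext ⟨a, b⟩
    simp [Submodule.mem_prod, eq_comm]
  apply Submodule.eq_of_le_of_finrank_eq
  · rw [hr]
    rintro _ ⟨a, rfl⟩
    rw [← Finset.univ_sum_single a, map_sum]
    exact L.sum_mem fun i _ => hs i _
  · rw [hr, LinearMap.finrank_range_of_inj LinearMap.inl_injective, hd]
    simp [Module.finrank_pi_fintype, mul_comm]
end

section
/- Let V be an n-dimensional complex vector space with n ≥ 2, and let p, q satisfy p + q ≥ 2n − 1, p ≥ q, and p − q ≤ 1. Identify the dual of V^p × (V*)^q with (V*)^p × V^q via the canonical pairing. Suppose E is a linear subspace of V^p × (V*)^q whose annihilator Ann(E) ⊆ (V*)^p × V^q consists entirely of points (η_1,…,η_p, w_1,…,w_q) such that η_i(w_j) = 0 for all i, j, every n-element subfamily of (η_1,…,η_p) is linearly dependent, and every n-element subfamily of (w_1,…,w_q) is linearly dependent. Then dim E ≥ q·n + (p − q). -/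
open Module in
lemma aux_finrank_map {M N : Type*} [AddCommGroup M] [Module ℂ M] [AddCommGroup N] [Module ℂ N]
    [FiniteDimensional ℂ M] (S : Submodule ℂ M) (T : M →ₗ[ℂ] N) :
    finrank ℂ S = finrank ℂ (S.map T) + finrank ℂ (S ⊓ LinearMap.ker T : Submodule ℂ M) := by
  have h := LinearMap.finrank_range_add_finrank_ker (T.domRestrict S)
  rw [LinearMap.range_domRestrict, LinearMap.ker_domRestrict] at h
  rw [← h]
  congr 1
  have e := Submodule.finrank_map_subtype_eq S ((LinearMap.ker T).submoduleOf S)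
  rw [Submodule.submoduleOf, Submodule.map_comap_subtype] at e
  exact e.symm

open Module in
lemma aux_hom {V F : Type*} [AddCommGroup V] [Module ℂ V] [FiniteDimensional ℂ V]
    [AddCommGroup F] [Module ℂ F] [FiniteDimensional ℂ F]
    (S : Submodule ℂ (V →ₗ[ℂ] F)) (W : Submodule ℂ V) (R : Submodule ℂ F)
    (h : ∀ g ∈ S, ∀ x ∈ W, g x ∈ R) :
    finrank ℂ S + finrank ℂ W * (finrank ℂ F - finrank ℂ R) ≤ finrank ℂ V * finrank ℂ F := by
  let T : (V →ₗ[ℂ] F) →ₗ[ℂ] (W →ₗ[ℂ] (F ⧸ R)) :=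
    (LinearMap.lcomp ℂ (F ⧸ R) W.subtype).comp (LinearMap.compRight ℂ R.mkQ)
  have hT : ∀ g x, T g x = R.mkQ (g x) := fun g x => rfl
  have hs : Function.Surjective T := by
    intro k
    obtain ⟨i, hi⟩ := R.mkQ.exists_rightInverse_of_surjective (Submodule.range_mkQ R)
    obtain ⟨j, hj⟩ := LinearMap.exists_extend (i.comp k)
    refine ⟨j, ?_⟩
    ext x
    rw [hT]
    have := LinearMap.congr_fun hj x
    simp only [LinearMap.comp_apply, Submodule.subtype_apply] at this
    rw [this]
    exact LinearMap.congr_fun hi (k x)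
  have h1 := LinearMap.finrank_range_add_finrank_ker T
  rw [LinearMap.range_eq_top.2 hs, finrank_top, finrank_linearMap, finrank_linearMap] at h1
  have h2 : S ≤ LinearMap.ker T := by
    intro g hg
    rw [LinearMap.mem_ker]
    ext x
    rw [hT]
    simpa using h g hg x x.2
  have h3 := Submodule.finrank_mono h2
  have h4 := Submodule.finrank_quotient_add_finrank R
  have h5 : finrank ℂ (F ⧸ R) = finrank ℂ F - finrank ℂ R := by omega
  rw [h5] at h1
  omega

open Module in
lemma aux_pi {M : Type*} [AddCommGroup M] [Module ℂ M] [FiniteDimensional ℂ M] (q : ℕ)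
    (S : Submodule ℂ (Fin q → M)) (W : Submodule ℂ M) (h : ∀ s ∈ S, ∀ j, s j ∈ W) :
    finrank ℂ S ≤ q * finrank ℂ W := by
  have h1 : S ≤ LinearMap.range (W.subtype.compLeft (Fin q)) := by
    intro s hs
    exact ⟨fun j => ⟨s j, h s hs j⟩, rfl⟩
  have h2 := Submodule.finrank_mono h1
  have h3 := LinearMap.finrank_range_le (W.subtype.compLeft (Fin q))
  rw [finrank_pi_fintype] at h3
  simp at h3
  omega

open Module in
lemma aux_range {V : Type*} [AddCommGroup V] [Module ℂ V] [FiniteDimensional ℂ V] {p : ℕ}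
    (f g : V →ₗ[ℂ] (Fin p → ℂ))
    (hmax : ∀ t : ℂ, finrank ℂ (LinearMap.range (f + t • g)) ≤ finrank ℂ (LinearMap.range f))
    (z : Fin p → ℂ) (hz : ∀ t : ℂ, t ≠ 0 → z ∈ LinearMap.range (f + t • g)) :
    z ∈ LinearMap.range f := by
  by_contra hzf
  let b := finBasis ℂ (LinearMap.range f)
  choose e he using fun i => (b i).2
  have hb : LinearIndependent ℂ (fun i => f (e i)) := by
    have := b.linearIndependent.map' (LinearMap.range f).subtype (Submodule.ker_subtype _)
    have e' : (fun i => f (e i)) = (LinearMap.range f).subtype ∘ b := funext he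
    rw [e']
    exact this
  let v : ℂ → Option (Fin (finrank ℂ (LinearMap.range f))) → (Fin p → ℂ) :=
    fun t o => Option.elim o z (fun i => f (e i) + t • g (e i))
  have hv0 : LinearIndependent ℂ (v 0) := by
    rw [linearIndependent_option]
    refine ⟨?_, ?_⟩
    · have e' : (v 0 ∘ (fun i => some i)) = (fun i => f (e i)) := by
        funext i
        simp [v]
      exact e' ▸ hb
    · intro hm
      apply hzf
      refine (Submodule.span_le.2 ?_) hm
      rintro _ ⟨i, rfl⟩
      simp [v]
  have hc : Continuous v := by
    refine continuous_pi fun o => ?_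
    cases o
    · exact continuous_const
    · simp only [v, Option.elim]; fun_prop
  have ho : IsOpen {t : ℂ | LinearIndependent ℂ (v t)} :=
    (isOpen_setOfPred_linearIndependent (𝕜 := ℂ)).preimage hc
  have hn : ∀ᶠ t in nhdsWithin (0:ℂ) {0}ᶜ, LinearIndependent ℂ (v t) :=
    nhdsWithin_le_nhds (ho.mem_nhds hv0)
  obtain ⟨t, ht, ht0⟩ := (hn.and self_mem_nhdsWithin).exists
  have hle : Submodule.span ℂ (Set.range (v t)) ≤ LinearMap.range (f + t • g) := by
    rw [Submodule.span_le]
    rintro _ ⟨o, rfl⟩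
    cases o with
    | none => exact hz t ht0
    | some i => exact ⟨e i, by simp [v]⟩
  have h1 := Submodule.finrank_mono hle
  rw [finrank_span_eq_card ht] at h1
  have := hmax t
  simp at h1
  omega

open Module in
lemma aux_dieudonne {V : Type*} [AddCommGroup V] [Module ℂ V] [FiniteDimensional ℂ V] {p : ℕ}
    (hp : finrank ℂ V ≤ p) (U : Submodule ℂ (V →ₗ[ℂ] (Fin p → ℂ)))
    (hU : ∀ g ∈ U, finrank ℂ (LinearMap.range g) + 1 ≤ finrank ℂ V) :
    finrank ℂ U ≤ p * (finrank ℂ V - 1) := by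
  obtain ⟨f, hfU, hf⟩ : ∃ f ∈ U, ∀ g ∈ U,
      finrank ℂ (LinearMap.range g) ≤ finrank ℂ (LinearMap.range f) := by
    have hfin : ((fun g : V →ₗ[ℂ] (Fin p → ℂ) => finrank ℂ (LinearMap.range g)) ''
        (U : Set (V →ₗ[ℂ] (Fin p → ℂ)))).Finite := by
      refine (Set.finite_Iic (finrank ℂ V)).subset ?_
      rintro _ ⟨g, _, rfl⟩
      exact LinearMap.finrank_range_le g
    obtain ⟨m, hm⟩ := hfin.exists_maximal ⟨_, 0, U.zero_mem, rfl⟩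
    obtain ⟨f, hfU, rfl⟩ := hm.1
    refine ⟨f, hfU, fun g hg => ?_⟩
    by_contra hlt
    push Not at hlt
    exact absurd (hm.2 ⟨g, hg, rfl⟩ hlt.le) (by simpa using hlt)
  obtain ⟨V1, hV1⟩ := (LinearMap.ker f).exists_isCompl
  have hR : ∀ x, ∃ y ∈ V1, f y = f x := by
    intro x
    have : x ∈ LinearMap.ker f ⊔ V1 := by rw [hV1.sup_eq_top]; trivial
    obtain ⟨a, ha, y, hy, rfl⟩ := Submodule.mem_sup.1 this
    exact ⟨y, hy, by simp [LinearMap.mem_ker.1 ha]⟩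
  have hmax : ∀ g ∈ U, ∀ t : ℂ,
      finrank ℂ (LinearMap.range (f + t • g)) ≤ finrank ℂ (LinearMap.range f) :=
    fun g hg t => hf _ (U.add_mem hfU (U.smul_mem t hg))
  have c1 : ∀ g ∈ U, ∀ x, f x = 0 → g x ∈ LinearMap.range f := by
    intro g hg x hx
    refine aux_range f g (hmax g hg) _ fun t ht => ⟨t⁻¹ • x, ?_⟩
    simp [hx, ht]
  have c2 : ∀ g ∈ U, ∀ x y, f x = 0 → g x = f y → g y ∈ LinearMap.range f := by
    intro g hg x y hx hxy
    refine aux_range f g (hmax g hg) _ fun t ht => ⟨-(t⁻¹ * t⁻¹) • (x - t • y), ?_⟩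
    simp only [map_smul, map_sub, LinearMap.add_apply, LinearMap.smul_apply, hx, hxy]
    ext i
    simp only [Pi.smul_apply, Pi.sub_apply, Pi.add_apply, smul_eq_mul, Pi.zero_apply]
    field_simp
    ring
  -- restriction to V1
  let T : (V →ₗ[ℂ] (Fin p → ℂ)) →ₗ[ℂ] (V1 →ₗ[ℂ] (Fin p → ℂ)) :=
    LinearMap.lcomp ℂ (Fin p → ℂ) V1.subtype
  have hT : ∀ g x, T g x = g x := fun g x => rfl
  let K := U ⊓ LinearMap.ker T
  have hK1 : ∀ k ∈ K, ∀ y ∈ V1, k y = 0 := by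
    intro k hk y hy
    have := LinearMap.congr_fun (LinearMap.mem_ker.1 hk.2) ⟨y, hy⟩
    rwa [hT] at this
  let W' : Submodule ℂ (Fin p → ℂ) := ⨆ k : K, LinearMap.range k.1
  let W : Submodule ℂ V1 := W'.comap (f.comp V1.subtype)
  have hfinj : Function.Injective (f.comp V1.subtype) := by
    rw [← LinearMap.ker_eq_bot, LinearMap.ker_eq_bot']
    intro y hy
    have : (y : V) ∈ LinearMap.ker f ⊓ V1 := ⟨hy, y.2⟩
    rw [hV1.inf_eq_bot] at this
    exact Subtype.ext ((Submodule.mem_bot ℂ).1 this)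
  have hkx : ∀ k ∈ K, ∀ x, ∃ x' y, f x' = 0 ∧ y ∈ V1 ∧ k x' = f y ∧ k x = f y := by
    intro k hk x
    have : x ∈ LinearMap.ker f ⊔ V1 := by rw [hV1.sup_eq_top]; trivial
    obtain ⟨a, ha, y, hy, rfl⟩ := Submodule.mem_sup.1 this
    obtain ⟨y0, hy0⟩ := c1 k hk.1 a ha
    obtain ⟨y', hy', h'⟩ := hR y0
    exact ⟨a, y', ha, hy', by rw [h', hy0], by rw [h', hy0, map_add, hK1 k hk y hy, add_zero]⟩
  have hW'le : W' ≤ LinearMap.range (f.comp V1.subtype) := by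
    refine iSup_le ?_
    rintro ⟨k, hk⟩ _ ⟨x, rfl⟩
    obtain ⟨x', y, -, hy, -, h⟩ := hkx k hk x
    exact ⟨⟨y, hy⟩, h.symm⟩
  have hWW : finrank ℂ W = finrank ℂ W' := by
    have : W.map (f.comp V1.subtype) = W' := by
      rw [Submodule.map_comap_eq, inf_eq_right]; exact hW'le
    rw [← this]
    exact (LinearEquiv.finrank_eq (Submodule.equivMapOfInjective _ hfinj W))
  -- g maps W to range f
  have hgW : ∀ g ∈ U.map T, ∀ y ∈ W, g y ∈ LinearMap.range f := by
    rintro _ ⟨g, hg, rfl⟩ y hy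
    rw [hT]
    have key : W' ≤ ((LinearMap.range f).comap (T g)).map (f.comp V1.subtype) := by
      refine iSup_le ?_
      rintro ⟨k, hk⟩ _ ⟨x, rfl⟩
      obtain ⟨x', y2, hx', hy2, h2, h2'⟩ := hkx k hk x
      refine ⟨⟨y2, hy2⟩, ?_, h2'.symm⟩
      change g y2 ∈ LinearMap.range f
      obtain ⟨y0, hy0⟩ := c1 g hg x' hx'
      obtain ⟨y1, hy1, h1⟩ := hR y0
      have e1 := c2 g hg x' y1 hx' (by rw [h1, hy0])
      have e2 := c2 (g + k) (U.add_mem hg hk.1) x' (y1 + y2) hx'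
        (by simp [h1, hy0, h2])
      have : (g + k) (y1 + y2) = g y1 + g y2 := by
        simp [hK1 k hk _ hy1, hK1 k hk _ hy2]
      rw [this] at e2
      exact (Submodule.add_mem_iff_right _ e1).1 e2
    obtain ⟨y', hy', h⟩ := key hy
    have := hfinj h
    subst this
    exact hy'
  have d1 := aux_hom (U.map T) W (LinearMap.range f) hgW
  have d2 : finrank ℂ K ≤ finrank ℂ (LinearMap.ker f) * finrank ℂ W' := by
    let Φ : K →ₗ[ℂ] (LinearMap.ker f →ₗ[ℂ] W') :=
      { toFun := fun k => LinearMap.codRestrict W' (k.1.comp (LinearMap.ker f).subtype)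
          (fun x => (le_iSup (fun k : K => LinearMap.range k.1) k) ⟨_, rfl⟩)
        map_add' := fun a b => by ext; rfl
        map_smul' := fun a b => by ext; rfl }
    have hΦ : Function.Injective Φ := by
      intro k k' hk
      refine Subtype.ext (LinearMap.ext fun x => ?_)
      have : x ∈ LinearMap.ker f ⊔ V1 := by rw [hV1.sup_eq_top]; trivial
      obtain ⟨a, ha, y, hy, rfl⟩ := Submodule.mem_sup.1 this
      have h1 : k.1 a = k'.1 a := congrArg Subtype.val (LinearMap.congr_fun hk ⟨a, ha⟩)
      rw [map_add, map_add, h1, hK1 k.1 k.2 y hy, hK1 k'.1 k'.2 y hy]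
    have := LinearMap.finrank_le_finrank_of_injective hΦ
    rwa [finrank_linearMap] at this
  have d3 := aux_finrank_map U T
  have d4 := LinearMap.finrank_range_add_finrank_ker f
  have d5 := Submodule.finrank_add_eq_of_isCompl hV1
  have d6 := hU f hfU
  rw [finrank_fin_fun] at d1
  rw [hWW] at d1
  change finrank ℂ U = _ + finrank ℂ K at d3
  have d7 : finrank ℂ V1 = finrank ℂ (LinearMap.range f) := by omega
  rw [d7] at d1
  generalize finrank ℂ (LinearMap.range f) = r at *
  generalize finrank ℂ W' = w at *
  generalize finrank ℂ (LinearMap.ker f) = s at *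
  have d8 : s * w ≤ w * (p - r) := by
    rw [mul_comm]; exact Nat.mul_le_mul_left _ (by omega)
  have d9 : r * p ≤ p * (finrank ℂ V - 1) := by
    rw [mul_comm]; exact Nat.mul_le_mul_left _ (by omega)
  omega

/-- If the annihilator of a subspace `E ⊆ V^p × (V*)^q` (with respect to the canonical
pairing with `(V*)^p × V^q`) is contained in the null cone of the dual `SL_n`-module,
then `dim E ≥ q·n + (p − q)`. -/
theorem stmt_9 {V : Type*} [AddCommGroup V] [Module ℂ V] [FiniteDimensional ℂ V]
    (n p q : ℕ) (hn : Module.finrank ℂ V = n) (h2 : 2 ≤ n)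
    (hpq : 2 * n - 1 ≤ p + q) (hqp : q ≤ p) (hpq1 : p ≤ q + 1)
    (E : Submodule ℂ ((Fin p → V) × (Fin q → Module.Dual ℂ V)))
    (hann : ∀ z : (Fin p → Module.Dual ℂ V) × (Fin q → V),
      (∀ y ∈ E, (∑ i, z.1 i (y.1 i)) + (∑ j, y.2 j (z.2 j)) = 0) →
      ((∀ (i : Fin p) (j : Fin q), z.1 i (z.2 j) = 0) ∧
       (∀ s : Finset (Fin p), s.card = n →
         ¬ LinearIndependent ℂ (fun i : s => z.1 i.1)) ∧
       (∀ t : Finset (Fin q), t.card = n →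
         ¬ LinearIndependent ℂ (fun j : t => z.2 j.1)))) :
    q * n + (p - q) ≤ Module.finrank ℂ E := by
  classical
  let Ψ : ((Fin p → Module.Dual ℂ V) × (Fin q → V)) →ₗ[ℂ] Module.Dual ℂ E :=
    { toFun := fun z =>
        { toFun := fun y => (∑ i, z.1 i (y.1.1 i)) + (∑ j, y.1.2 j (z.2 j))
          map_add' := fun a b => by
            simp [Finset.sum_add_distrib]; ring
          map_smul' := fun c a => by
            simp [Finset.mul_sum, mul_add] }
      map_add' := fun a b => by
        ext y; simp [Finset.sum_add_distrib]; ring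
      map_smul' := fun c a => by
        ext y; simp [Finset.mul_sum, mul_add] }
  have hΨ : ∀ z y, Ψ z y = (∑ i, z.1 i (y.1.1 i)) + (∑ j, y.1.2 j (z.2 j)) := fun z y => rfl
  let N := LinearMap.ker Ψ
  have hN : ∀ z ∈ N, (∀ (i : Fin p) (j : Fin q), z.1 i (z.2 j) = 0) ∧
       (∀ s : Finset (Fin p), s.card = n →
         ¬ LinearIndependent ℂ (fun i : s => z.1 i.1)) := by
    intro z hz
    have := hann z (fun y hy => by
      have := LinearMap.congr_fun (LinearMap.mem_ker.1 hz) ⟨y, hy⟩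
      rwa [hΨ] at this)
    exact ⟨this.1, this.2.1⟩
  have e1 := LinearMap.finrank_range_add_finrank_ker Ψ
  have e2 : Module.finrank ℂ (LinearMap.range Ψ) ≤ Module.finrank ℂ E := by
    rw [← Subspace.dual_finrank_eq (K := ℂ) (V := E)]
    exact Submodule.finrank_le _
  have e3 : Module.finrank ℂ ((Fin p → Module.Dual ℂ V) × (Fin q → V)) = p * n + q * n := by
    rw [Module.finrank_prod, Module.finrank_pi_fintype, Module.finrank_pi_fintype]
    simp [hn, Subspace.dual_finrank_eq]
  rw [e3] at e1
  suffices hmain : Module.finrank ℂ N ≤ p * (n - 1) + q by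
    obtain ⟨m, rfl⟩ : ∃ m, n = m + 1 := ⟨n - 1, by omega⟩
    change _ + Module.finrank ℂ N = _ at e1
    simp only [Nat.add_sub_cancel] at hmain
    have : p * (m + 1) = p * m + p := by ring
    omega
  let P := N.map (LinearMap.fst ℂ (Fin p → Module.Dual ℂ V) (Fin q → V))
  let K := N.comap (LinearMap.inr ℂ (Fin p → Module.Dual ℂ V) (Fin q → V))
  have f1 : Module.finrank ℂ N = Module.finrank ℂ P + Module.finrank ℂ K := by
    rw [aux_finrank_map N (LinearMap.fst ℂ (Fin p → Module.Dual ℂ V) (Fin q → V))]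
    congr 1
    have : K.map (LinearMap.inr ℂ (Fin p → Module.Dual ℂ V) (Fin q → V)) =
        N ⊓ LinearMap.ker (LinearMap.fst ℂ (Fin p → Module.Dual ℂ V) (Fin q → V)) := by
      rw [Submodule.map_comap_eq, LinearMap.range_inr, inf_comm]
    rw [← this]
    exact (LinearEquiv.finrank_eq
      (Submodule.equivMapOfInjective _ LinearMap.inr_injective K)).symm
  let W : Submodule ℂ V := ⨆ j : Fin q, K.map (LinearMap.proj j)
  have hKW : ∀ s ∈ K, ∀ j, s j ∈ W := fun s hs j =>
    (le_iSup (fun j : Fin q => K.map (LinearMap.proj j)) j) ⟨s, hs, rfl⟩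
  have f2 := aux_pi q K W hKW
  have hPW : ∀ η ∈ P, ∀ i, η i ∈ W.dualAnnihilator := by
    rintro _ ⟨⟨η, w⟩, hz, rfl⟩ i
    rw [Submodule.mem_dualAnnihilator]
    have : W ≤ LinearMap.ker (η i) := by
      refine iSup_le fun j => ?_
      rintro _ ⟨s, hs, rfl⟩
      have a1 := (hN _ hz).1 i j
      have a2 := (hN _ (N.add_mem hz hs)).1 i j
      simp only [LinearMap.inr_apply, Prod.mk_add_mk, add_zero, Pi.add_apply, map_add] at a1 a2
      rw [a1, zero_add] at a2
      exact a2
    exact fun w hw => this hw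
  by_cases hw : 1 ≤ Module.finrank ℂ W
  · have f3 := aux_pi p P _ hPW
    have f4 := Subspace.finrank_add_finrank_dualAnnihilator_eq W
    rw [hn] at f4
    generalize Module.finrank ℂ W = w at *
    generalize Module.finrank ℂ W.dualAnnihilator = u at *
    obtain ⟨v, rfl⟩ : ∃ v, w = v + 1 := ⟨w - 1, by omega⟩
    have : n - 1 = v + u := by omega
    rw [this, f1]
    have := Nat.mul_le_mul_right v hqp
    calc _ ≤ p * u + q * (v + 1) := add_le_add f3 f2
      _ ≤ _ := by linarith
  · have hw0 : Module.finrank ℂ W = 0 := by omega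
    rw [hw0] at f2
    let L : (Fin p → Module.Dual ℂ V) →ₗ[ℂ] (V →ₗ[ℂ] (Fin p → ℂ)) :=
      { toFun := fun η => LinearMap.pi η
        map_add' := fun a b => by ext; rfl
        map_smul' := fun a b => by ext; rfl }
    have hL : Function.Injective L := by
      intro a b h
      ext i x
      exact congrFun (LinearMap.congr_fun h x) i
    have f5 := aux_dieudonne (p := p) (V := V) (by omega) (P.map L) (by
      rintro _ ⟨_, ⟨⟨η, w⟩, hz, rfl⟩, rfl⟩
      by_contra hlt
      have g1 := LinearMap.finrank_range_add_finrank_ker (L η)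
      change ¬ (Module.finrank ℂ (LinearMap.range (L η)) + 1 ≤ _) at hlt
      have g2 : LinearMap.ker (L η) = ⊥ := by
        rw [← Submodule.finrank_eq_zero (R := ℂ)]; omega
      have g3 : Submodule.span ℂ (Set.range η) = ⊤ := by
        have : (Submodule.span ℂ (Set.range η)).dualCoannihilator = ⊥ := by
          rw [eq_bot_iff, ← g2]
          intro x hx
          rw [Submodule.mem_dualCoannihilator] at hx
          rw [LinearMap.mem_ker]
          ext i
          exact hx _ (Submodule.subset_span ⟨i, rfl⟩)
        rw [← Subspace.dualCoannihilator_dualAnnihilator_eq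
          (W := Submodule.span ℂ (Set.range η)), this, Submodule.dualAnnihilator_bot]
      obtain ⟨κ, a, ha, hsp, hli⟩ := exists_linearIndependent' ℂ η
      have : Fintype κ := Fintype.ofInjective a ha
      have hc : Fintype.card κ = n := by
        rw [← finrank_span_eq_card hli, hsp, g3, finrank_top, Subspace.dual_finrank_eq, hn]
      refine (hN _ hz).2 (Finset.univ.map ⟨a, ha⟩) (by simp [hc]) ?_
      have hex : ∀ i : (Finset.univ.map ⟨a, ha⟩ : Finset (Fin p)), ∃ k, a k = i.1 := by
        intro i
        obtain ⟨k, -, hk⟩ := Finset.mem_map.1 i.2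
        exact ⟨k, hk⟩
      choose b hb using hex
      have hbi : Function.Injective b := fun i j h => by
        apply Subtype.ext
        rw [← hb i, ← hb j, h]
      have hfin := hli.comp b hbi
      have e' : (η ∘ a) ∘ b = fun i => η i.1 := funext fun i => by
        simp only [Function.comp_apply, hb]
      rw [e'] at hfin
      exact hfin)
    have f6 : Module.finrank ℂ (P.map L) = Module.finrank ℂ P :=
      (LinearEquiv.finrank_eq (Submodule.equivMapOfInjective _ hL P)).symm
    rw [f6, hn] at f5
    omega
end

section
/- Let B be a nondegenerate symmetric bilinear form on an n-dimensional complex vector space V, and let k ≥ 1. (a) Every linear subspace L ⊆ V^k such that B(v_i, v_j) = 0 for every (v_1,…,v_k) ∈ L and all 1 ≤ i, j ≤ k satisfies dim L ≤ k·⌊n/2⌋. (b) There exists such a subspace L with dim L = k·⌊n/2⌋; in fact one may take L = W^k for any B-isotropic subspace W ⊆ V of dimension ⌊n/2⌋. Hence the maximal dimension of such a subspace is exactly k·⌊n/2⌋. -/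
theorem aux_finrank_pi {V : Type*} [AddCommGroup V] [Module ℂ V] [FiniteDimensional ℂ V]
    (k : ℕ) (p : Fin k → Submodule ℂ V) :
    Module.finrank ℂ ↥(Submodule.pi Set.univ p) = ∑ i, Module.finrank ℂ (p i) := by
  let e : ↥(Submodule.pi Set.univ p) ≃ₗ[ℂ] ((i : Fin k) → p i) :=
    { toFun := fun v i => ⟨v.1 i, v.2 i (Set.mem_univ i)⟩
      invFun := fun f => ⟨fun i => (f i).1, fun i _ => (f i).2⟩
      map_add' := fun _ _ => rfl
      map_smul' := fun _ _ => rfl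
      left_inv := fun _ => rfl
      right_inv := fun _ => rfl }
  rw [e.finrank_eq, Module.finrank_pi_fintype]

theorem aux_orth {V : Type*} [AddCommGroup V] [Module ℂ V] [FiniteDimensional ℂ V]
    (B : V →ₗ[ℂ] V →ₗ[ℂ] ℂ)
    (hsymm : ∀ u v, B u v = B v u)
    (hnd : ∀ u, (∀ v, B u v = 0) → u = 0) (W : Submodule ℂ V) :
    ∃ P : Submodule ℂ V, (∀ x, x ∈ P ↔ ∀ w ∈ W, B w x = 0) ∧
      Module.finrank ℂ P + Module.finrank ℂ W = Module.finrank ℂ V := by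
  have hN : LinearMap.BilinForm.Nondegenerate B :=
    ⟨hnd, fun u h => hnd u fun v => by rw [hsymm]; exact h v⟩
  refine ⟨LinearMap.BilinForm.orthogonal B W, fun x => Iff.rfl, ?_⟩
  have h1 := LinearMap.BilinForm.finrank_orthogonal hN W
  have := Submodule.finrank_le W
  omega

theorem aux_iso_le {V : Type*} [AddCommGroup V] [Module ℂ V] [FiniteDimensional ℂ V]
    (B : V →ₗ[ℂ] V →ₗ[ℂ] ℂ)
    (hsymm : ∀ u v, B u v = B v u)
    (hnd : ∀ u, (∀ v, B u v = 0) → u = 0) (W : Submodule ℂ V)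
    (hW : ∀ w ∈ W, ∀ w' ∈ W, B w w' = 0) :
    Module.finrank ℂ W ≤ Module.finrank ℂ V / 2 := by
  obtain ⟨P, hP, hd⟩ := aux_orth B hsymm hnd W
  have : W ≤ P := fun x hx => (hP x).2 fun w hw => hW w hw x hx
  have := Submodule.finrank_mono this
  omega

theorem aux_sup {V : Type*} [AddCommGroup V] [Module ℂ V] [FiniteDimensional ℂ V]
    (W : Submodule ℂ V) (x : V) (hx : x ∉ W) :
    Module.finrank ℂ ↥(W ⊔ Submodule.span ℂ {x}) = Module.finrank ℂ W + 1 := by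
  have h1 := Submodule.finrank_add_le_finrank_add_finrank W (Submodule.span ℂ {x})
  have h2 := finrank_span_le_card (R := ℂ) ({x} : Set V)
  simp only [Set.toFinset_singleton, Finset.card_singleton] at h2
  have h3 : W < W ⊔ Submodule.span ℂ {x} := by
    refine lt_of_le_of_ne le_sup_left fun h => hx ?_
    rw [h]
    exact Submodule.mem_sup_right (Submodule.mem_span_singleton_self x)
  have h4 := Submodule.finrank_lt_finrank_of_lt h3
  omega

theorem aux_exists {V : Type*} [AddCommGroup V] [Module ℂ V] [FiniteDimensional ℂ V]
    (B : V →ₗ[ℂ] V →ₗ[ℂ] ℂ)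
    (hsymm : ∀ u v, B u v = B v u)
    (hnd : ∀ u, (∀ v, B u v = 0) → u = 0) (d : ℕ) (hd : 2 * d ≤ Module.finrank ℂ V) :
    ∃ W : Submodule ℂ V, (∀ w ∈ W, ∀ w' ∈ W, B w w' = 0) ∧ Module.finrank ℂ W = d := by
  induction d with
  | zero => exact ⟨⊥, by simp, by simp⟩
  | succ d ih =>
    obtain ⟨W, hW, hWd⟩ := ih (by omega)
    obtain ⟨P, hP, hPd⟩ := aux_orth B hsymm hnd W
    have key : ∀ Q : Submodule ℂ V, Module.finrank ℂ Q < Module.finrank ℂ P →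
        ∃ u ∈ P, u ∉ Q := by
      intro Q hQ
      by_contra! h
      have := Submodule.finrank_mono (show P ≤ Q from h)
      omega
    have hx : ∃ x ∈ P, x ∉ W ∧ B x x = 0 := by
      obtain ⟨u, huP, huW⟩ := key W (by omega)
      by_cases hu : B u u = 0
      · exact ⟨u, huP, huW, hu⟩
      obtain ⟨v, hvP, hvW⟩ := key (W ⊔ Submodule.span ℂ {u}) (by rw [aux_sup W u huW]; omega)
      obtain ⟨s, hs⟩ := IsAlgClosed.exists_eq_mul_self (discrim (B u u) (2 * B u v) (B v v))
      obtain ⟨t, ht⟩ := exists_quadratic_eq_zero hu ⟨s, hs⟩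
      refine ⟨v + t • u, P.add_mem hvP (P.smul_mem t huP), fun h => hvW ?_, ?_⟩
      · have : v = (v + t • u) + (-t) • u := by module
        rw [this]
        exact Submodule.add_mem_sup h
          (Submodule.smul_mem _ _ (Submodule.mem_span_singleton_self u))
      · simp only [map_add, map_smul, LinearMap.add_apply, LinearMap.smul_apply, smul_eq_mul]
        rw [hsymm v u]
        linear_combination ht
    obtain ⟨x, hxP, hxW, hxx⟩ := hx
    refine ⟨W ⊔ Submodule.span ℂ {x}, ?_, by rw [aux_sup W x hxW, hWd]⟩
    intro a ha b hb
    obtain ⟨a1, ha1, a2, ha2, rfl⟩ := Submodule.mem_sup.1 ha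
    obtain ⟨b1, hb1, b2, hb2, rfl⟩ := Submodule.mem_sup.1 hb
    obtain ⟨r, rfl⟩ := Submodule.mem_span_singleton.1 ha2
    obtain ⟨r', rfl⟩ := Submodule.mem_span_singleton.1 hb2
    have e1 := (hP x).1 hxP a1 ha1
    have e2 := (hP x).1 hxP b1 hb1
    rw [hsymm] at e2
    simp [hW a1 ha1 b1 hb1, e1, e2, hxx]

/-- The maximal dimension of a linear subspace of the null cone of `k` copies of the
defining representation of the orthogonal group of a nondegenerate symmetric form `B` on
an `n`-dimensional space is exactly `k·⌊n/2⌋`: (a) every such subspace has dimension at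
most `k·⌊n/2⌋`; (b) one of dimension `k·⌊n/2⌋` exists, and indeed `W^k` works for any
`B`-isotropic subspace `W` of dimension `⌊n/2⌋`. -/
theorem stmt_10 {V : Type*} [AddCommGroup V] [Module ℂ V] [FiniteDimensional ℂ V]
    (n k : ℕ) (hn : Module.finrank ℂ V = n) (hk : 1 ≤ k)
    (B : V →ₗ[ℂ] V →ₗ[ℂ] ℂ)
    (hsymm : ∀ u v, B u v = B v u)
    (hnd : ∀ u, (∀ v, B u v = 0) → u = 0) :
    (∀ L : Submodule ℂ (Fin k → V),
      (∀ v ∈ L, ∀ i j, B (v i) (v j) = 0) → Module.finrank ℂ L ≤ k * (n / 2)) ∧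
    (∃ L : Submodule ℂ (Fin k → V),
      (∀ v ∈ L, ∀ i j, B (v i) (v j) = 0) ∧ Module.finrank ℂ L = k * (n / 2)) ∧
    (∀ W : Submodule ℂ V, (∀ w ∈ W, ∀ w' ∈ W, B w w' = 0) →
      Module.finrank ℂ W = n / 2 →
      (∀ v ∈ Submodule.pi Set.univ (fun _ : Fin k => W), ∀ i j, B (v i) (v j) = 0) ∧
      Module.finrank ℂ ↥(Submodule.pi Set.univ (fun _ : Fin k => W)) = k * (n / 2)) := by
  have h3 : ∀ W : Submodule ℂ V, (∀ w ∈ W, ∀ w' ∈ W, B w w' = 0) →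
      Module.finrank ℂ W = n / 2 →
      (∀ v ∈ Submodule.pi Set.univ (fun _ : Fin k => W), ∀ i j, B (v i) (v j) = 0) ∧
      Module.finrank ℂ ↥(Submodule.pi Set.univ (fun _ : Fin k => W)) = k * (n / 2) := by
    intro W hW hd
    refine ⟨fun v hv i j => hW _ (hv i (Set.mem_univ i)) _ (hv j (Set.mem_univ j)), ?_⟩
    rw [aux_finrank_pi]
    simp [hd]
  refine ⟨?_, ?_, h3⟩
  · intro L hL
    have hle : L ≤ Submodule.pi Set.univ (fun i => L.map (LinearMap.proj i)) :=
      fun v hv i _ => ⟨v, hv, rfl⟩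
    refine (Submodule.finrank_mono hle).trans ?_
    rw [aux_finrank_pi]
    have : ∀ i ∈ (Finset.univ : Finset (Fin k)),
        Module.finrank ℂ ↥(L.map (LinearMap.proj i : (Fin k → V) →ₗ[ℂ] V)) ≤ n / 2 := by
      intro i _
      rw [← hn]
      refine aux_iso_le B hsymm hnd _ ?_
      rintro _ ⟨v, hv, rfl⟩ _ ⟨w, hw, rfl⟩
      have e1 := hL _ (L.add_mem hv hw) i i
      have e2 := hL v hv i i
      have e3 := hL w hw i i
      simp only [Pi.add_apply, map_add, LinearMap.add_apply, e2, e3, hsymm (w i) (v i)] at e1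
      simp only [LinearMap.proj_apply]
      linear_combination e1 / 2
    simpa using Finset.sum_le_sum this
  · obtain ⟨W, hW, hd⟩ := aux_exists B hsymm hnd (n / 2) (by omega)
    exact ⟨_, h3 W hW hd⟩
end

section
/- Let Φ be an irreducible, reduced, crystallographic root system of rank at least 2, with roots lying in the dual of a finite-dimensional vector space 𝔥 (i.e. roots are linear functionals on 𝔥 and span 𝔥*). Then for every nonzero h ∈ 𝔥, the number of roots α ∈ Φ with α(h) ≠ 0 is at least 4. -/
/-- For an irreducible, reduced, crystallographic root system of rank at least 2, realized
as a finite set of linear functionals `Φ` on `𝔥` (spanning `𝔥*`, with coroots in `𝔥`),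
every nonzero `h ∈ 𝔥` has at least `4` roots not vanishing on it. -/
theorem stmt_11 {𝔥 : Type*} [AddCommGroup 𝔥] [Module ℂ 𝔥] [FiniteDimensional ℂ 𝔥]
    (hrank : 2 ≤ Module.finrank ℂ 𝔥)
    (Φ : Finset (Module.Dual ℂ 𝔥))
    (h0 : (0 : Module.Dual ℂ 𝔥) ∉ Φ)
    (hspan : Submodule.span ℂ (Φ : Set (Module.Dual ℂ 𝔥)) = ⊤)
    (coroot : Module.Dual ℂ 𝔥 → 𝔥)
    (hcoroot : ∀ α ∈ Φ, α (coroot α) = 2)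
    (hrefl : ∀ α ∈ Φ, ∀ β ∈ Φ, β - β (coroot α) • α ∈ Φ)
    (hcrys : ∀ α ∈ Φ, ∀ β ∈ Φ, ∃ z : ℤ, β (coroot α) = (z : ℂ))
    (hred : ∀ α ∈ Φ, ∀ c : ℂ, c • α ∈ Φ → c = 1 ∨ c = -1)
    (hirr : ¬ ∃ Φ₁ Φ₂ : Finset (Module.Dual ℂ 𝔥),
      Φ₁.Nonempty ∧ Φ₂.Nonempty ∧ (Φ : Set (Module.Dual ℂ 𝔥)) = ↑Φ₁ ∪ ↑Φ₂ ∧ Disjoint Φ₁ Φ₂ ∧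
      ∀ α ∈ Φ₁, ∀ β ∈ Φ₂, α (coroot β) = 0 ∧ β (coroot α) = 0) :
    ∀ h : 𝔥, h ≠ 0 → 4 ≤ {α : Module.Dual ℂ 𝔥 | α ∈ Φ ∧ α h ≠ 0}.ncard := by
  classical
  intro h hh
  by_contra hlt
  push Not at hlt
  have hset : {α : Module.Dual ℂ 𝔥 | α ∈ Φ ∧ α h ≠ 0} = ↑(Φ.filter (fun α => α h ≠ 0)) := by
    ext α; simp
  rw [hset, Set.ncard_coe_finset] at hlt
  have hneg : ∀ α ∈ Φ, -α ∈ Φ := by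
    intro α hα
    have h1 := hrefl α hα α hα
    rw [hcoroot α hα] at h1
    have h2 : α - (2 : ℂ) • α = -α := by module
    rwa [h2] at h1
  have hnene : ∀ α : Module.Dual ℂ 𝔥, α h ≠ 0 → α ≠ -α := by
    intro α hα he
    have h1 : α h = -(α h) := by
      conv_lhs => rw [he]
      simp
    exact hα (self_eq_neg.mp h1)
  have key : ∀ γ ∈ Φ, γ h ≠ 0 → ∀ β ∈ Φ, β h ≠ 0 → β = γ ∨ β = -γ := by
    intro γ hγ hγh β hβ hβh
    by_contra hc
    push Not at hc
    have hsub : ({γ, -γ, β, -β} : Finset (Module.Dual ℂ 𝔥)) ⊆ Φ.filter (fun α => α h ≠ 0) := by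
      intro x hx
      simp only [Finset.mem_insert, Finset.mem_singleton] at hx
      rw [Finset.mem_filter]
      rcases hx with rfl | rfl | rfl | rfl
      · exact ⟨hγ, hγh⟩
      · exact ⟨hneg _ hγ, by simpa using hγh⟩
      · exact ⟨hβ, hβh⟩
      · exact ⟨hneg _ hβ, by simpa using hβh⟩
    have hcard : ({γ, -γ, β, -β} : Finset (Module.Dual ℂ 𝔥)).card = 4 := by
      have h1 := hnene γ hγh
      have h2 := hnene β hβh
      have h3 : γ ≠ -β := fun e => hc.2 (by rw [e, neg_neg])
      have h4 : -γ ≠ -β := fun e => hc.1 (neg_injective e).symm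
      rw [Finset.card_insert_of_notMem, Finset.card_insert_of_notMem,
        Finset.card_insert_of_notMem, Finset.card_singleton]
      · simpa using h2
      · simp only [Finset.mem_insert, Finset.mem_singleton, not_or]
        exact ⟨hc.2.symm, h4⟩
      · simp only [Finset.mem_insert, Finset.mem_singleton, not_or]
        exact ⟨h1, hc.1.symm, h3⟩
    have := Finset.card_le_card hsub
    omega
  have hne : ∃ α ∈ Φ, α h ≠ 0 := by
    by_contra hc
    push Not at hc
    apply hh
    rw [← Module.forall_dual_apply_eq_zero_iff ℂ]
    intro f
    have hf : f ∈ Submodule.span ℂ (Φ : Set (Module.Dual ℂ 𝔥)) := by rw [hspan]; trivial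
    induction hf using Submodule.span_induction with
    | mem x hx => exact hc x hx
    | zero => simp
    | add x y _ _ hx hy => simp [hx, hy]
    | smul a x _ hx => simp [hx]
  obtain ⟨α, hα, hαh⟩ := hne
  apply hirr
  refine ⟨Φ.filter (fun α => α h ≠ 0), Φ.filter (fun α => α h = 0), ⟨α, by simp [hα, hαh]⟩, ?_, ?_,
    ?_, ?_⟩
  · by_contra hc
    rw [Finset.not_nonempty_iff_eq_empty, Finset.filter_eq_empty_iff] at hc
    have hle : (⊤ : Submodule ℂ (Module.Dual ℂ 𝔥)) ≤ Submodule.span ℂ {α} := by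
      rw [← hspan, Submodule.span_le]
      intro β hβ
      have hm := Submodule.mem_span_singleton_self (R := ℂ) α
      rcases key α hα hαh β hβ (hc hβ) with rfl | rfl
      · exact hm
      · exact neg_mem hm
    have h1 := Submodule.finrank_mono hle
    have h2 := finrank_span_singleton (K := ℂ) (v := α) (fun e => h0 (e ▸ hα))
    rw [finrank_top, Subspace.dual_finrank_eq, h2] at h1
    omega
  · ext x
    simp only [Finset.coe_filter, Set.mem_union, Set.mem_setOf_eq, Finset.mem_coe]
    tauto
  · rw [Finset.disjoint_left]
    intro x hx hy
    exact (Finset.mem_filter.mp hx).2 (Finset.mem_filter.mp hy).2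
  · intro γ hγ β hβ
    obtain ⟨hγ, hγh⟩ := Finset.mem_filter.mp hγ
    obtain ⟨hβ, hβh⟩ := Finset.mem_filter.mp hβ
    have hβ0 : β ≠ 0 := fun e => h0 (e ▸ hβ)
    constructor
    · have h1 := hrefl β hβ γ hγ
      rcases key γ hγ hγh _ h1 (by simpa [hβh] using hγh) with e | e
      · rw [sub_eq_self] at e
        exact (smul_eq_zero.mp e).resolve_right hβ0
      · exfalso
        have e2 := congrArg (fun f : Module.Dual ℂ 𝔥 => f h) e
        simp [hβh] at e2
        exact hγh (self_eq_neg.mp e2)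
    · by_contra hz
      have h1 := hrefl γ hγ β hβ
      have hmul : ∃ c : ℂ, β = c • γ := by
        rcases key γ hγ hγh _ h1 (by simp [hβh, hz, hγh]) with e | e
        · exact ⟨1 + β (coroot γ), by rw [add_smul, one_smul]; exact sub_eq_iff_eq_add.mp e⟩
        · exact ⟨-1 + β (coroot γ), by rw [add_smul, neg_one_smul]; exact sub_eq_iff_eq_add.mp e⟩
      obtain ⟨c, hc⟩ := hmul
      have hc0 : c = 0 := by
        have := hβh
        rw [hc] at this
        simpa [hγh] using this
      exact hβ0 (by rw [hc, hc0, zero_smul])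
end
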